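/- Let 𝓛 : ℝ^n × ℝ^m → ℝ be differentiable in its first argument with ‖∇_x 𝓛(x,y) − ∇_x 𝓛(x̄,y)‖ ≤ L_xx ‖x − x̄‖ for all x, x̄, y. Let T ≥ 1, let α_0 = 1 and α_k ∈ (0,1) for 1 ≤ k ≤ T−1, Γ_0 = 1, Γ_k = (1−α_k)Γ_{k−1}, and let γ_k, λ_k > 0. Given x_0 = x̃_0 ∈ ℝ^n and arbitrary y_1, …, y_T ∈ ℝ^m, define for k = 0, …, T−1: z_{k+1} = (1−α_k)x̃_k + α_k x_k, x_{k+1} = x_k − γ_k ∇_x 𝓛(z_{k+1}, y_{k+1}), and x̃_{k+1} = z_{k+1} − λ_k ∇_x 𝓛(z_{k+1}, y_{k+1}). With C_k := 1 − L_xx γ_k − (L_xx (γ_k−λ_k)²/(2 α_k Γ_k γ_k)) ∑_{τ=k}^{T−1} Γ_τ, the following holds: ∑_{k=0}^{T−1} (𝓛(x_{k+1}, y_{k+1}) − 𝓛(x_k, y_{k+1})) ≤ − ∑_{k=0}^{T−1} γ_k C_k ‖∇_x 𝓛(z_{k+1}, y_{k+1})‖². -/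

import Mathlib

open RealInnerProductSpace Finset

theorem descent_aux {E : Type*} [NormedAddCommGroup E] [InnerProductSpace ℝ E] [CompleteSpace E]
    (f : E → ℝ) (g : E → E) (hg : ∀ x, HasGradientAt f (g x) x) (K : ℝ)
    (hLip : ∀ x xb, ‖g x - g xb‖ ≤ K * ‖x - xb‖) (x v : E) :
    f (x + v) ≤ f x + inner ℝ (g x) v + K / 2 * ‖v‖ ^ 2 := by
  have hd : ∀ t : ℝ, HasDerivAt
      (fun t : ℝ => f (x + t • v) - t * inner ℝ (g x) v - K / 2 * ‖v‖ ^ 2 * t ^ 2)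
      (inner ℝ (g (x + t • v)) v - inner ℝ (g x) v - K * ‖v‖ ^ 2 * t) t := by
    intro t
    have h1 : HasDerivAt (fun t : ℝ => x + t • v) v t := by
      simpa using ((hasDerivAt_id t).smul_const v).const_add x
    have h2 := (hg (x + t • v)).hasFDerivAt.comp_hasDerivAt t h1
    have h3 := (hasDerivAt_id t).mul_const (inner ℝ (g x) v)
    have h4 := ((hasDerivAt_id t).pow 2).const_mul (K / 2 * ‖v‖ ^ 2)
    refine ((h2.sub h3).sub h4).congr_deriv ?_
    simp
    ring
  have hanti : AntitoneOn
      (fun t : ℝ => f (x + t • v) - t * inner ℝ (g x) v - K / 2 * ‖v‖ ^ 2 * t ^ 2)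
      (Set.Icc 0 1) := by
    apply antitoneOn_of_deriv_nonpos (convex_Icc 0 1)
    · exact fun t _ => (hd t).continuousAt.continuousWithinAt
    · exact fun t _ => (hd t).differentiableAt.differentiableWithinAt
    · intro t ht
      rw [interior_Icc] at ht
      rw [(hd t).deriv, ← inner_sub_left]
      have h1 := real_inner_le_norm (g (x + t • v) - g x) v
      have h2 := hLip (x + t • v) x
      rw [add_sub_cancel_left, norm_smul, Real.norm_of_nonneg ht.1.le] at h2
      nlinarith [mul_le_mul_of_nonneg_right h2 (norm_nonneg v)]
  have := hanti (Set.left_mem_Icc.2 zero_le_one) (Set.right_mem_Icc.2 zero_le_one) zero_le_one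
  simp at this
  linarith

theorem norm_convex_aux {E : Type*} [NormedAddCommGroup E] [InnerProductSpace ℝ E]
    (a b : ℝ) (ha : 0 < a) (ha1 : a ≤ 1) (d G : E) :
    ‖(1 - a) • d + b • G‖ ^ 2 ≤ (1 - a) * ‖d‖ ^ 2 + b ^ 2 / a * ‖G‖ ^ 2 := by
  have h1 : ‖(1 - a) • d + b • G‖ ≤ (1 - a) * ‖d‖ + |b| * ‖G‖ := by
    refine (norm_add_le _ _).trans ?_
    rw [norm_smul, norm_smul, Real.norm_of_nonneg (by linarith), Real.norm_eq_abs]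
  have h2 : ‖(1 - a) • d + b • G‖ ^ 2 ≤ ((1 - a) * ‖d‖ + |b| * ‖G‖) ^ 2 :=
    pow_le_pow_left₀ (norm_nonneg _) h1 2
  refine h2.trans ?_
  have h3 : b ^ 2 / a * ‖G‖ ^ 2 = a * (|b| * ‖G‖ / a) ^ 2 := by
    rw [div_pow, mul_pow, sq_abs]; field_simp
  have h4 : |b| * ‖G‖ = a * (|b| * ‖G‖ / a) := by field_simp
  rw [h3]
  generalize |b| * ‖G‖ / a = w at *
  rw [h4]
  nlinarith [mul_nonneg (mul_nonneg ha.le (sub_nonneg.2 ha1)) (sq_nonneg (‖d‖ - w))]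

theorem swap_aux (T : ℕ) (hT : 1 ≤ T) (Γ c : ℕ → ℝ) :
    ∑ k ∈ Finset.range T, Γ k * ∑ τ ∈ Finset.range (k + 1), c τ
      = ∑ k ∈ Finset.range T, c k * ∑ τ ∈ Finset.Icc k (T - 1), Γ τ := by
  simp_rw [Finset.mul_sum]
  rw [Finset.sum_comm' (t' := Finset.range T) (s' := fun k => Finset.Icc k (T - 1))]
  · exact Finset.sum_congr rfl fun _ _ => Finset.sum_congr rfl fun _ _ => mul_comm _ _
  · intro a b
    simp only [Finset.mem_range, Finset.mem_Icc]
    omega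

/-- Cumulative descent inequality for the PDM primal iterates:
`∑_{k=0}^{T−1} (𝓛(x_{k+1},y_{k+1}) − 𝓛(x_k,y_{k+1})) ≤ −∑_{k=0}^{T−1} γₖCₖ‖∇ₓ𝓛(z_{k+1},y_{k+1})‖²`. -/
theorem stmt8 {n m : ℕ}
    (L : EuclideanSpace ℝ (Fin n) → EuclideanSpace ℝ (Fin m) → ℝ)
    (gx : EuclideanSpace ℝ (Fin n) → EuclideanSpace ℝ (Fin m) → EuclideanSpace ℝ (Fin n))
    (hgx : ∀ x y, HasGradientAt (fun x' => L x' y) (gx x y) x)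
    (Lxx : ℝ) (hLxx : 0 ≤ Lxx)
    (hLip : ∀ x xb y, ‖gx x y - gx xb y‖ ≤ Lxx * ‖x - xb‖)
    (T : ℕ) (hT : 1 ≤ T)
    (α Γ γ lam : ℕ → ℝ)
    (hα0 : α 0 = 1) (hα : ∀ k, 1 ≤ k → k ≤ T - 1 → α k ∈ Set.Ioo (0 : ℝ) 1)
    (hΓ0 : Γ 0 = 1) (hΓ : ∀ k, 1 ≤ k → Γ k = (1 - α k) * Γ (k - 1))
    (hγ : ∀ k, 0 < γ k) (hlam : ∀ k, 0 < lam k)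
    (x xt z : ℕ → EuclideanSpace ℝ (Fin n)) (y : ℕ → EuclideanSpace ℝ (Fin m))
    (hinit : xt 0 = x 0)
    (hz : ∀ k < T, z (k + 1) = (1 - α k) • xt k + α k • x k)
    (hx : ∀ k < T, x (k + 1) = x k - γ k • gx (z (k + 1)) (y (k + 1)))
    (hxt : ∀ k < T, xt (k + 1) = z (k + 1) - lam k • gx (z (k + 1)) (y (k + 1)))
    (C : ℕ → ℝ)
    (hC : ∀ k, C k = 1 - Lxx * γ k -
        Lxx * (γ k - lam k) ^ 2 / (2 * α k * Γ k * γ k) * ∑ τ ∈ Finset.Icc k (T - 1), Γ τ) :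
    ∑ k ∈ Finset.range T, (L (x (k + 1)) (y (k + 1)) - L (x k) (y (k + 1))) ≤
      - ∑ k ∈ Finset.range T, γ k * C k * ‖gx (z (k + 1)) (y (k + 1))‖ ^ 2 := by
  have hαk : ∀ k < T, 0 < α k ∧ α k ≤ 1 := by
    intro k hk
    rcases Nat.eq_zero_or_pos k with rfl | h
    · rw [hα0]; norm_num
    · have := hα k h (by omega)
      exact ⟨this.1, this.2.le⟩
  have hΓpos : ∀ k < T, 0 < Γ k := by
    intro k
    induction k with
    | zero => intro _; rw [hΓ0]; norm_num
    | succ k ih =>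
      intro hk
      rw [hΓ (k + 1) (by omega)]
      have := hα (k + 1) (by omega) (by omega)
      exact mul_pos (by linarith [this.2]) (ih (by omega))
  let c : ℕ → ℝ := fun k => (γ k - lam k) ^ 2 / (α k * Γ k) * ‖gx (z (k + 1)) (y (k + 1))‖ ^ 2
  have hc : ∀ k < T, 0 ≤ c k := fun k hk =>
    mul_nonneg (div_nonneg (sq_nonneg _) (mul_pos (hαk k hk).1 (hΓpos k hk)).le) (sq_nonneg _)
  have hstep : ∀ k < T, ‖xt (k + 1) - x (k + 1)‖ ^ 2 ≤
      (1 - α k) * ‖xt k - x k‖ ^ 2 + Γ k * c k := by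
    intro k hk
    have e : xt (k + 1) - x (k + 1) = (1 - α k) • (xt k - x k)
        + (γ k - lam k) • gx (z (k + 1)) (y (k + 1)) := by
      rw [hxt k hk, hx k hk]
      generalize gx (z (k + 1)) (y (k + 1)) = G
      rw [hz k hk]
      module
    rw [e]
    refine (norm_convex_aux _ _ (hαk k hk).1 (hαk k hk).2 _ _).trans (le_of_eq ?_)
    have := (hαk k hk).1
    have := hΓpos k hk
    simp only [c]
    field_simp
  have hd : ∀ k < T, (1 - α k) * ‖xt k - x k‖ ^ 2 ≤ Γ k * ∑ τ ∈ Finset.range k, c τ := by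
    intro k
    induction k with
    | zero => intro _; simp [hα0]
    | succ k ih =>
      intro hk
      have h1 := ih (by omega)
      have h2 := hstep k (by omega)
      have h3 := hΓ (k + 1) (by omega)
      rw [Nat.add_sub_cancel] at h3
      rw [h3, mul_assoc, Finset.sum_range_succ]
      refine mul_le_mul_of_nonneg_left ?_ (by linarith [(hαk (k + 1) hk).2])
      linarith
  have hd2 : ∀ k < T, (1 - α k) ^ 2 * ‖xt k - x k‖ ^ 2
      ≤ Γ k * ∑ τ ∈ Finset.range (k + 1), c τ := by
    intro k hk
    have h1 := hd k hk
    have h2 := hαk k hk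
    have h3 : 0 ≤ (1 - α k) * ‖xt k - x k‖ ^ 2 :=
      mul_nonneg (by linarith) (sq_nonneg _)
    rw [Finset.sum_range_succ]
    nlinarith [mul_nonneg (hΓpos k hk).le (hc k hk), mul_nonneg h2.1.le h3]
  have hdesc : ∀ k < T, L (x (k + 1)) (y (k + 1)) - L (x k) (y (k + 1)) ≤
      -(γ k * (1 - Lxx * γ k) * ‖gx (z (k + 1)) (y (k + 1))‖ ^ 2)
        + Lxx / 2 * (Γ k * ∑ τ ∈ Finset.range (k + 1), c τ) := by
    intro k hk
    have h0 := descent_aux (fun x' => L x' (y (k + 1))) (fun x' => gx x' (y (k + 1)))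
      (fun x' => hgx x' _) Lxx (fun a b => hLip a b _) (x k)
      (-(γ k • gx (z (k + 1)) (y (k + 1))))
    have h1 := hLip (z (k + 1)) (x k) (y (k + 1))
    have e : z (k + 1) - x k = (1 - α k) • (xt k - x k) := by rw [hz k hk]; module
    rw [e, norm_smul, Real.norm_of_nonneg (by linarith [(hαk k hk).2])] at h1
    have h2 := hd2 k hk
    have h3 := mul_le_mul_of_nonneg_left h2 (div_nonneg hLxx zero_le_two)
    simp only [← sub_eq_add_neg, ← hx k hk] at h0
    rw [inner_neg_right, norm_neg, norm_smul, Real.norm_of_nonneg (hγ k).le,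
      inner_smul_right] at h0
    have h4 := real_inner_le_norm (gx (z (k + 1)) (y (k + 1)) - gx (x k) (y (k + 1)))
      (gx (z (k + 1)) (y (k + 1)))
    rw [inner_sub_left, real_inner_self_eq_norm_sq] at h4
    have h5 := h4.trans (mul_le_mul_of_nonneg_right h1 (norm_nonneg _))
    have h6 := mul_le_mul_of_nonneg_left h5 (hγ k).le
    have h7 := mul_nonneg hLxx (sq_nonneg
      ((1 - α k) * ‖xt k - x k‖ - γ k * ‖gx (z (k + 1)) (y (k + 1))‖))
    linarith
  refine (Finset.sum_le_sum fun k hk => hdesc k (Finset.mem_range.1 hk)).trans (le_of_eq ?_)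
  rw [Finset.sum_add_distrib, ← Finset.mul_sum, swap_aux T hT, Finset.mul_sum,
    ← Finset.sum_add_distrib, ← Finset.sum_neg_distrib]
  refine Finset.sum_congr rfl fun k hk => ?_
  have hk' := Finset.mem_range.1 hk
  have a1 := (hαk k hk').1.ne'
  have a2 := (hΓpos k hk').ne'
  have a3 := (hγ k).ne'
  rw [hC k]
  simp only [c]
  generalize ∑ τ ∈ Finset.Icc k (T - 1), Γ τ = S
  field_simp
  ring
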